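/- arXiv:2104.01808 — 4 statements merged into one kernel-verified Lean document; each statement's English description precedes it below -/
import Mathlib

section
/- Let ε > 0 and Δ > 0 be real numbers, let a, b ∈ ℤ with |a − b| ≤ Δ, and let X be a random variable distributed according to the symmetric geometric distribution Geom(e^{ε/Δ}). Then for every z ∈ ℤ, Pr[a + X = z] ≤ e^{ε} · Pr[b + X = z]. (This is the privacy guarantee of the geometric mechanism: adding Geom(e^{ε/GS_q}) noise to a query q of sensitivity GS_q gives ε-differential privacy.) -/
open MeasureTheory ProbabilityTheory

/-- `X` is distributed according to the symmetric geometric distribution `Geom(α)`: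
its probability mass function at `l ∈ ℤ` is `((α − 1)/(α + 1)) · α^{−|l|}`. -/
def IsSymGeom {Ω : Type*} [MeasureSpace Ω] (α : ℝ) (X : Ω → ℤ) : Prop :=
  Measurable X ∧
    ∀ l : ℤ, (ℙ : Measure Ω) {ω | X ω = l} =
      ENNReal.ofReal ((α - 1) / (α + 1) * α ^ (-|l|))

/-- The unnormalised mass function of `Geom(e^t)` changes by a factor of at most `e^(t|k - l|)`
between the integers `k` and `l`. -/
theorem exp_zpow_neg_abs_le {t : ℝ} (ht : 0 ≤ t) (k l : ℤ) :
    Real.exp t ^ (-|k|) ≤ Real.exp (t * |(k : ℝ) - l|) * Real.exp t ^ (-|l|) := by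
  rw [← Real.rpow_intCast, ← Real.rpow_intCast, ← Real.exp_mul, ← Real.exp_mul, ← Real.exp_add, Real.exp_le_exp]
  push_cast
  have h : |(l : ℝ)| - |(k : ℝ)| ≤ |(k : ℝ) - l| := by
    rw [abs_sub_comm]
    exact abs_sub_abs_le_abs_sub _ _
  linarith [mul_le_mul_of_nonneg_left h ht]

/-- Privacy guarantee of the geometric mechanism: if `|a − b| ≤ Δ` and `X ∼ Geom(e^{ε/Δ})`,
then for every `z`, `Pr[a + X = z] ≤ e^ε · Pr[b + X = z]`. -/
theorem geometric_mechanism_dp {Ω : Type*} [MeasureSpace Ω]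
    [IsProbabilityMeasure (ℙ : Measure Ω)]
    (ε Δ : ℝ) (hε : 0 < ε) (hΔ : 0 < Δ)
    (a b : ℤ) (hab : |(a : ℝ) - (b : ℝ)| ≤ Δ)
    (X : Ω → ℤ) (hX : IsSymGeom (Real.exp (ε / Δ)) X) :
    ∀ z : ℤ,
      (ℙ : Measure Ω) {ω | a + X ω = z} ≤
        ENNReal.ofReal (Real.exp ε) * (ℙ : Measure Ω) {ω | b + X ω = z} := by
  intro z
  have shift (c : ℤ) : {ω | c + X ω = z} = {ω | X ω = z - c} := by
    ext ω
    simp only [Set.mem_ofPred_eq]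
    lia
  have ht : 0 ≤ ε / Δ := (div_pos hε hΔ).le
  have hnorm : 0 ≤ (Real.exp (ε / Δ) - 1) / (Real.exp (ε / Δ) + 1) :=
    div_nonneg (sub_nonneg.2 (Real.one_le_exp ht)) (by positivity)
  have hdist : ε / Δ * |((z - a : ℤ) : ℝ) - (z - b : ℤ)| ≤ ε := by
    have heq : |((z - a : ℤ) : ℝ) - (z - b : ℤ)| = |(a : ℝ) - b| := by
      push_cast
      rw [sub_sub_sub_cancel_left, abs_sub_comm]
    rw [heq]
    calc ε / Δ * |(a : ℝ) - b| ≤ ε / Δ * Δ := by gcongr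
      _ = ε := div_mul_cancel₀ ε hΔ.ne'
  rw [shift a, shift b, hX.2, hX.2, ← ENNReal.ofReal_mul (Real.exp_pos ε).le, mul_left_comm]
  refine ENNReal.ofReal_le_ofReal (mul_le_mul_of_nonneg_left ?_ hnorm)
  refine (exp_zpow_neg_abs_le ht (z - a) (z - b)).trans ?_
  gcongr
end

section
/- Let u, s ≥ 1 be integers, let x ∈ ℝ^u be a fixed vector, let i ∈ {1,…,u}, and let h : {1,…,u} → {1,…,s} and g : {1,…,u} → {−1,+1} be random functions, let η be a real random variable, and suppose that g(i) is uniformly distributed on {−1,+1} and is independent of the tuple (h, (g(j))_{j≠i}, η). Then the random variable D = g(i)·( Σ_{j : h(j)=h(i)} g(j)·x_j + η ) − x_i has a distribution symmetric about zero, i.e., D and −D have the same distribution. (D is the error of the point estimate for coordinate i extracted from a count-sketch row perturbed by noise η.) -/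
open MeasureTheory ProbabilityTheory

/-- A random sign that is uniform on `{-1, 1}` has the same law as its negative. -/
theorem map_neg_eq_map_of_uniform_sign {Ω : Type*} [MeasurableSpace Ω] {μ : Measure Ω}
    [IsProbabilityMeasure μ] {ε : Ω → ℝ} (hε : Measurable ε)
    (hval : ∀ ω, ε ω = 1 ∨ ε ω = -1) (hunif : μ {ω | ε ω = 1} = 1 / 2) :
    μ.map (fun ω => -ε ω) = μ.map ε := by
  have hε_neg : Measurable fun ω => -ε ω := hε.neg
  have h_meas : MeasurableSet {ω | ε ω = 1} := hε (measurableSet_singleton 1)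
  have h_neg : μ {ω | ε ω = -1} = 1 / 2 := by
    have h_compl : {ω | ε ω = -1} = {ω | ε ω = 1}ᶜ := by
      ext ω
      rcases hval ω with h | h <;> simp [h] <;> norm_num
    rw [h_compl, prob_compl_eq_one_sub h_meas, hunif, one_div,
      ENNReal.one_sub_inv_two]
  ext A hA
  rw [Measure.map_apply hε_neg hA, Measure.map_apply hε hA]
  by_cases h₁ : (1 : ℝ) ∈ A <;> by_cases h₂ : (-1 : ℝ) ∈ A
  · congr 1
    ext ω
    rcases hval ω with h | h <;> simp [h, h₁, h₂]
  · have e₁ : (fun ω => -ε ω) ⁻¹' A = {ω | ε ω = -1} := by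
      ext ω
      rcases hval ω with h | h <;> simp [h, h₁, h₂] <;> norm_num
    have e₂ : ε ⁻¹' A = {ω | ε ω = 1} := by
      ext ω
      rcases hval ω with h | h <;> simp [h, h₁, h₂] <;> norm_num
    rw [e₁, e₂, h_neg, hunif]
  · have e₁ : (fun ω => -ε ω) ⁻¹' A = {ω | ε ω = 1} := by
      ext ω
      rcases hval ω with h | h <;> simp [h, h₁, h₂] <;> norm_num
    have e₂ : ε ⁻¹' A = {ω | ε ω = -1} := by
      ext ω
      rcases hval ω with h | h <;> simp [h, h₁, h₂] <;> norm_num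
    rw [e₁, e₂, h_neg, hunif]
  · congr 1
    ext ω
    rcases hval ω with h | h <;> simp [h, h₁, h₂]

/-- Multiplying by an independent variable with symmetric law makes the law symmetric. -/
theorem map_mul_eq_map_neg_mul_of_indepFun {Ω : Type*} [MeasurableSpace Ω] {μ : Measure Ω}
    [IsProbabilityMeasure μ] {ε Y : Ω → ℝ} (hε : Measurable ε) (hY : Measurable Y)
    (hsymm : μ.map (fun ω => -ε ω) = μ.map ε) (hindep : IndepFun ε Y μ) :
    μ.map (fun ω => ε ω * Y ω) = μ.map (fun ω => -(ε ω * Y ω)) := by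
  have hε_neg : Measurable fun ω => -ε ω := hε.neg
  have hindep' : IndepFun (fun ω => -ε ω) Y μ := hindep.comp measurable_neg measurable_id
  have h_joint : μ.map (fun ω => (ε ω, Y ω)) = μ.map (fun ω => (-ε ω, Y ω)) := by
    rw [(indepFun_iff_map_prod_eq_prod_map_map hε.aemeasurable hY.aemeasurable).1 hindep,
      (indepFun_iff_map_prod_eq_prod_map_map hε_neg.aemeasurable hY.aemeasurable).1 hindep',
      hsymm]
  have h_mul : Measurable fun p : ℝ × ℝ => p.1 * p.2 := measurable_fst.mul measurable_snd
  have h_map := congrArg (Measure.map fun p : ℝ × ℝ => p.1 * p.2) h_joint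
  rw [Measure.map_map h_mul (hε.prodMk hY), Measure.map_map h_mul (hε_neg.prodMk hY)] at h_map
  simpa only [Function.comp_def, neg_mul] using h_map

/-- The error of the point estimate for coordinate `i` extracted from a noisy
count-sketch row, where the sign `g(i)` is uniform on `{−1,+1}` and independent of
everything else, is symmetrically distributed about zero. -/
theorem countSketch_error_symmetric {Ω : Type*} [MeasureSpace Ω]
    [IsProbabilityMeasure (ℙ : Measure Ω)]
    (u s : ℕ) (hu : 1 ≤ u) (hs : 1 ≤ s)
    (x : Fin u → ℝ) (i : Fin u)
    (h : Ω → Fin u → Fin s) (g : Ω → Fin u → ℝ) (η : Ω → ℝ)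
    (hmeash : Measurable h) (hmeasg : Measurable g) (hmeasη : Measurable η)
    (hgval : ∀ ω j, g ω j = 1 ∨ g ω j = -1)
    (hgi_unif : (ℙ : Measure Ω) {ω | g ω i = 1} = 1 / 2)
    (hgi_indep : IndepFun (fun ω => g ω i)
      (fun ω => (h ω, (fun j : {j : Fin u // j ≠ i} => g ω j), η ω)) ℙ) :
    Measure.map
      (fun ω => g ω i * ((∑ j, if h ω j = h ω i then g ω j * x j else 0) + η ω) - x i) ℙ
    = Measure.map
      (fun ω => -(g ω i * ((∑ j, if h ω j = h ω i then g ω j * x j else 0) + η ω) - x i)) ℙ := by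
  let F : (Fin u → Fin s) × ({j : Fin u // j ≠ i} → ℝ) × ℝ → ℝ := fun p =>
    (∑ j : {j : Fin u // j ≠ i}, if p.1 j = p.1 i then p.2.1 j * x j else 0) + p.2.2
  have hF : Measurable F := by
    refine (Finset.measurable_sum _ fun j _ => ?_).add (by fun_prop)
    exact Measurable.ite (measurableSet_eq_fun (by fun_prop) (by fun_prop))
      (by fun_prop) measurable_const
  have hgi : Measurable fun ω => g ω i := by fun_prop
  let Y : Ω → ℝ := fun ω => F (h ω, (fun j : {j : Fin u // j ≠ i} => g ω j), η ω)
  have hY : Measurable Y := hF.comp (by fun_prop)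
  have h_error : ∀ ω, g ω i * ((∑ j, if h ω j = h ω i then g ω j * x j else 0) + η ω) - x i
      = g ω i * Y ω := by
    intro ω
    have h_sq : g ω i * g ω i = 1 := by rcases hgval ω i with e | e <;> simp [e]
    have h_split := Fintype.sum_eq_add_sum_subtype_ne
      (fun j => if h ω j = h ω i then g ω j * x j else 0) i
    simp only [if_true] at h_split
    simp only [Y, F]
    rw [h_split]
    linear_combination x i * h_sq
  simp only [h_error]
  exact map_mul_eq_map_neg_mul_of_indepFun hgi hY
    (map_neg_eq_map_of_uniform_sign hgi (fun ω => hgval ω i) hgi_unif)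
    (hgi_indep.comp measurable_id hF)
end

section
/- Let u, s ≥ 1 be integers, let x ∈ ℝ^u be a fixed vector, and let i ∈ {1,…,u}. Let h(1), …, h(u) be pairwise independent random variables, each uniformly distributed on {1,…,s}, and let g(1), …, g(u) be pairwise independent random variables, each uniformly distributed on {−1,+1}, with the family (h(j))_j independent of the family (g(j))_j. Then the count-sketch point estimate x̃_i = Σ_{j : h(j)=h(i)} g(i)·g(j)·x_j satisfies E[x̃_i] = x_i and Var[x̃_i] ≤ (Σ_{j≠i} x_j²)/s ≤ ‖x‖₂²/s. -/
open MeasureTheory ProbabilityTheory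

section Aux

variable {Ω : Type*} [MeasurableSpace Ω] {μ : Measure Ω} [IsProbabilityMeasure μ]

lemma integral_uniform_sign {g : Ω → ℝ} (hg : Measurable g)
    (hval : ∀ ω, g ω = 1 ∨ g ω = -1) (hunif : μ {ω | g ω = 1} = 1 / 2) :
    ∫ ω, g ω ∂μ = 0 := by
  have hset : MeasurableSet {ω | g ω = 1} := hg (measurableSet_singleton 1)
  have heq : g = fun ω => 2 * {ω | g ω = 1}.indicator (fun _ => (1 : ℝ)) ω - 1 := by
    funext ω
    rcases hval ω with h | h <;> norm_num [Set.indicator, h]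
  rw [heq, integral_sub (((integrable_const 1).indicator hset).const_mul 2)
    (integrable_const 1), integral_const_mul, integral_indicator_const _ hset]
  simp [Measure.real, hunif]

lemma integral_collision_of_uniform {s : ℕ} (hs : 1 ≤ s) {X Y : Ω → Fin s}
    (hX : Measurable X) (hY : Measurable Y)
    (hXunif : ∀ c, μ {ω | X ω = c} = (s : ENNReal)⁻¹)
    (hYunif : ∀ c, μ {ω | Y ω = c} = (s : ENNReal)⁻¹) (hXY : IndepFun X Y μ) :
    ∫ ω, (if X ω = Y ω then (1 : ℝ) else 0) ∂μ = (s : ℝ)⁻¹ := by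
  have hsX (c) : MeasurableSet {ω | X ω = c} := hX (measurableSet_singleton c)
  have hsY (c) : MeasurableSet {ω | Y ω = c} := hY (measurableSet_singleton c)
  have heq : (fun ω => if X ω = Y ω then (1 : ℝ) else 0) =
      fun ω => ∑ c, ({ω | X ω = c} ∩ {ω | Y ω = c}).indicator (fun _ => (1 : ℝ)) ω := by
    funext ω
    simp [Set.indicator, ite_and, eq_comm]
  have hinter (c) : μ ({ω | X ω = c} ∩ {ω | Y ω = c}) = (s : ENNReal)⁻¹ * (s : ENNReal)⁻¹ := by
    rw [← hXunif c, ← (hYunif c).trans (hXunif c).symm]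
    nth_rewrite 2 [(hYunif c).trans (hXunif c).symm]
    rw [mul_comm]
    exact hXY.measure_inter_preimage_eq_mul {c} {c}
      (measurableSet_singleton c) (measurableSet_singleton c)
  rw [heq, integral_finsetSum _ fun c _ =>
    (integrable_const 1).indicator ((hsX c).inter (hsY c))]
  simp_rw [integral_indicator_const _ ((hsX _).inter (hsY _)), Measure.real, hinter]
  have : (s : ℝ) ≠ 0 := by positivity
  simp [this]

end Aux

/-- Unbiasedness and the ℓ₂ variance guarantee of the (one-row) count-sketch point
estimate, under pairwise independent uniform hash values `h(j)` and pairwise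
independent uniform signs `g(j)`, with the `h`-family independent of the `g`-family. -/
theorem countSketch_unbiased_variance {Ω : Type*} [MeasureSpace Ω]
    [IsProbabilityMeasure (ℙ : Measure Ω)]
    (u s : ℕ) (hu : 1 ≤ u) (hs : 1 ≤ s)
    (x : Fin u → ℝ) (i : Fin u)
    (h : Fin u → Ω → Fin s) (g : Fin u → Ω → ℝ)
    (hmeash : ∀ j, Measurable (h j)) (hmeasg : ∀ j, Measurable (g j))
    (hunif : ∀ j (c : Fin s), (ℙ : Measure Ω) {ω | h j ω = c} = (s : ENNReal)⁻¹)
    (hhpair : ∀ j j' : Fin u, j ≠ j' → IndepFun (h j) (h j') ℙ)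
    (hgval : ∀ j ω, g j ω = 1 ∨ g j ω = -1)
    (hgunif : ∀ j, (ℙ : Measure Ω) {ω | g j ω = 1} = 1 / 2)
    (hgpair : ∀ j j' : Fin u, j ≠ j' → IndepFun (g j) (g j') ℙ)
    (hfam : IndepFun (fun ω => fun j => h j ω) (fun ω => fun j => g j ω) ℙ) :
    (∫ ω, ∑ j, (if h j ω = h i ω then g i ω * g j ω * x j else 0) ∂ℙ) = x i ∧
    variance (fun ω => ∑ j, if h j ω = h i ω then g i ω * g j ω * x j else 0) ℙ ≤
      (∑ j ∈ Finset.univ.erase i, x j ^ 2) / s ∧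
    (∑ j ∈ Finset.univ.erase i, x j ^ 2) / (s : ℝ) ≤ (∑ j, x j ^ 2) / s := by
  have hs_meas (j k) : MeasurableSet {a : Fin u → Fin s | a j = a k} :=
    measurableSet_eq_fun (measurable_pi_apply j) (measurable_pi_apply k)
  let b : Fin u → (Fin u → Fin s) → ℝ := fun j a => if a j = a i then 1 else 0
  have hb (j) : Measurable (b j) :=
    Measurable.ite (hs_meas j i) measurable_const measurable_const
  have hbi (ω) : b i (fun j => h j ω) = 1 := by simp [b]
  have hhm : Measurable fun ω j => h j ω := measurable_pi_lambda _ hmeash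
  have hgm : Measurable fun ω j => g j ω := measurable_pi_lambda _ hmeasg
  have hgsq (j ω) : g j ω * g j ω = 1 := by
    rcases hgval j ω with e | e <;> simp [e]
  have hgabs (j ω) : |g j ω| = 1 := by
    rcases hgval j ω with e | e <;> simp [e]
  have hbabs (j a) : |b j a| ≤ 1 := by
    by_cases e : a j = a i <;> simp [b, e]
  have hg0 (j) : ∫ ω, g j ω ∂(ℙ : Measure Ω) = 0 :=
    integral_uniform_sign (hmeasg j) (hgval j) (hgunif j)
  have hgg (j k) (hjk : j ≠ k) : ∫ ω, g j ω * g k ω ∂(ℙ : Measure Ω) = 0 := by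
    rw [(hgpair j k hjk).integral_fun_mul_eq_mul_integral
      (hmeasg j).aestronglyMeasurable (hmeasg k).aestronglyMeasurable, hg0, zero_mul]
  have hsplit (φ : (Fin u → Fin s) → ℝ) (ψ : (Fin u → ℝ) → ℝ)
      (hφ : Measurable φ) (hψ : Measurable ψ) :
      ∫ ω, φ (fun j => h j ω) * ψ (fun j => g j ω) ∂(ℙ : Measure Ω) =
        (∫ ω, φ (fun j => h j ω) ∂ℙ) * ∫ ω, ψ (fun j => g j ω) ∂ℙ :=
    (hfam.comp hφ hψ).integral_fun_mul_eq_mul_integral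
      (hφ.comp hhm).aestronglyMeasurable (hψ.comp hgm).aestronglyMeasurable
  let Y : Ω → ℝ := fun ω =>
    ∑ j ∈ Finset.univ.erase i, x j * (b j (fun j => h j ω) * g j ω)
  have hX : (fun ω => ∑ j, if h j ω = h i ω then g i ω * g j ω * x j else 0) =
      fun ω => x i + g i ω * Y ω := by
    funext ω
    rw [← Finset.add_sum_erase _ _ (Finset.mem_univ i), Finset.mul_sum]
    congr 1
    · simp [hgsq]
    · refine Finset.sum_congr rfl fun j _ => ?_
      by_cases e : h j ω = h i ω <;> simp [b, e]
      ring
  have hYm : Measurable Y := Finset.measurable_fun_sum _ fun j _ =>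
    (((hb j).comp hhm).mul (hmeasg j)).const_mul (x j)
  have hint (j k) : Integrable (fun ω => b j (fun j => h j ω) * b k (fun j => h j ω) *
      (g j ω * g k ω)) (ℙ : Measure Ω) := by
    refine Integrable.of_bound ((((hb j).comp hhm).mul ((hb k).comp hhm)).mul
      ((hmeasg j).mul (hmeasg k))).aestronglyMeasurable 1 (.of_forall fun ω => ?_)
    simp only [Real.norm_eq_abs, abs_mul, hgabs, mul_one]
    exact mul_le_one₀ (hbabs j fun j => h j ω) (abs_nonneg _) (hbabs k fun j => h j ω)
  have hmean : ∫ ω, x i + g i ω * Y ω ∂(ℙ : Measure Ω) = x i := by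
    have hint' (j) : Integrable (fun ω => x j * (b j (fun j => h j ω) * (g i ω * g j ω)))
        (ℙ : Measure Ω) := by
      simpa [hbi] using (hint i j).const_mul (x j)
    have e : (fun ω => g i ω * Y ω) = fun ω => ∑ j ∈ Finset.univ.erase i,
        x j * (b j (fun j => h j ω) * (g i ω * g j ω)) := by
      funext ω
      rw [Finset.mul_sum]
      exact Finset.sum_congr rfl fun j _ => by ring
    have e0 : ∫ ω, g i ω * Y ω ∂(ℙ : Measure Ω) = 0 := by
      rw [e, integral_finsetSum _ fun j _ => hint' j]
      refine Finset.sum_eq_zero fun j hj => ?_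
      rw [integral_const_mul, hsplit (b j) (fun a => a i * a j) (hb j)
        ((measurable_pi_apply i).mul (measurable_pi_apply j)),
        hgg i j (Finset.ne_of_mem_erase hj).symm]
      simp
    rw [integral_add (integrable_const _) (e ▸ integrable_finsetSum _ fun j _ => hint' j), e0]
    simp
  have hsq : ∫ ω, Y ω ^ 2 ∂(ℙ : Measure Ω) = (∑ j ∈ Finset.univ.erase i, x j ^ 2) / s := by
    have e : (fun ω => Y ω ^ 2) = fun ω => ∑ j ∈ Finset.univ.erase i,
        ∑ k ∈ Finset.univ.erase i, x j * x k *
          (b j (fun j => h j ω) * b k (fun j => h j ω) * (g j ω * g k ω)) := by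
      funext ω
      rw [sq, Finset.sum_mul_sum]
      exact Finset.sum_congr rfl fun j _ => Finset.sum_congr rfl fun k _ => by ring
    rw [e, integral_finsetSum _ fun j _ => integrable_finsetSum _ fun k _ =>
      (hint j k).const_mul _, Finset.sum_div]
    refine Finset.sum_congr rfl fun j hj => ?_
    rw [integral_finsetSum _ fun k _ => (hint j k).const_mul _,
      Finset.sum_eq_single_of_mem j hj]
    · have hji := Finset.ne_of_mem_erase hj
      have hbb (a) : b j a * b j a = b j a := by
        by_cases e : a j = a i <;> simp [b, e]
      simp_rw [integral_const_mul, hgsq, hbb, mul_one, b]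
      rw [integral_collision_of_uniform hs (hmeash j) (hmeash i) (hunif j) (hunif i)
        (hhpair j i hji)]
      ring
    · intro k _ hkj
      rw [integral_const_mul, hsplit (fun a => b j a * b k a) (fun a => a j * a k)
        ((hb j).mul (hb k)) ((measurable_pi_apply j).mul (measurable_pi_apply k)),
        hgg j k hkj.symm]
      simp
  refine ⟨?_, ?_, ?_⟩
  · rw [hX, hmean]
  · have hm : Measurable fun ω => x i + g i ω * Y ω := ((hmeasg i).mul hYm).const_add (x i)
    rw [hX, variance_eq_integral hm.aemeasurable, hmean, ← hsq]
    refine le_of_eq (integral_congr_ae (.of_forall fun ω => ?_))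
    simp only [add_sub_cancel_left, mul_pow]
    rw [sq (g i ω), hgsq, one_mul]
  · gcongr
    exact Finset.erase_subset _ _
end

section
/- Let u, s ≥ 1 be integers, let x ∈ ℝ^u be a fixed vector, and let i ∈ {1,…,u}. Let h(1), …, h(u) be pairwise independent random variables, each uniformly distributed on {1,…,s}, and let g(1), …, g(u) be any random variables taking values in {−1,+1}, independent of the family (h(j))_j. Then the count-sketch point estimate x̃_i = Σ_{j : h(j)=h(i)} g(i)·g(j)·x_j satisfies E[ |x̃_i − x_i| ] ≤ (Σ_{j≠i} |x_j|)/s ≤ ‖x‖₁/s. (This is the ℓ₁ error guarantee of the count sketch; by Markov's inequality, |x̃_i − x_i| = O(‖x‖₁/s) with constant probability.) -/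
open MeasureTheory ProbabilityTheory

/-- Two independent hash values, each uniform on `Fin s`, collide with probability `1 / s`. -/
theorem measureReal_eq_of_indepFun_uniform {Ω : Type*} [MeasurableSpace Ω] {μ : Measure Ω}
    {s : ℕ} (hs : s ≠ 0) {a b : Ω → Fin s} (ha : Measurable a) (hb : Measurable b)
    (hua : ∀ c, μ {ω | a ω = c} = (s : ENNReal)⁻¹) (hub : ∀ c, μ {ω | b ω = c} = (s : ENNReal)⁻¹)
    (hab : IndepFun a b μ) : μ.real {ω | a ω = b ω} = (s : ℝ)⁻¹ := by
  have hunion : {ω | a ω = b ω} = ⋃ c, a ⁻¹' {c} ∩ b ⁻¹' {c} := by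
    ext ω
    simp [eq_comm]
  have hinter (c : Fin s) :
      μ (a ⁻¹' {c} ∩ b ⁻¹' {c}) = (s : ENNReal)⁻¹ * (s : ENNReal)⁻¹ := by
    rw [hab.measure_inter_preimage_eq_mul _ _ (measurableSet_singleton c)
      (measurableSet_singleton c)]
    exact congrArg₂ _ (hua c) (hub c)
  have hdisj : Pairwise (Function.onFun Disjoint fun c => a ⁻¹' {c} ∩ b ⁻¹' {c}) := by
    intro c d hcd
    refine Set.disjoint_left.2 fun ω hc hd => hcd ?_
    exact hc.1.symm.trans hd.1
  have hs' : (s : ℝ) ≠ 0 := Nat.cast_ne_zero.2 hs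
  rw [measureReal_def, hunion, measure_iUnion hdisj fun c =>
    (ha (measurableSet_singleton c)).inter (hb (measurableSet_singleton c))]
  simp [hinter, hs']

/-- With signs `±1`, the point estimate of coordinate `i` is off by at most the total mass of the
other coordinates that collide with `i`. -/
theorem abs_countSketch_estimate_sub_le {ι κ : Type*} [Fintype ι] [DecidableEq ι] [DecidableEq κ]
    (h : ι → κ) (g x : ι → ℝ) (hg : ∀ j, |g j| = 1) (i : ι) :
    |(∑ j, if h j = h i then g i * g j * x j else 0) - x i| ≤
      ∑ j ∈ Finset.univ.erase i, if h j = h i then |x j| else 0 := by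
  have hii : g i * g i = 1 := by rw [← abs_mul_abs_self, hg, one_mul]
  rw [← Finset.add_sum_erase _ _ (Finset.mem_univ i), if_pos rfl, hii, one_mul,
    add_sub_cancel_left]
  refine (Finset.abs_sum_le_sum_abs _ _).trans (Finset.sum_le_sum fun j _ => ?_)
  split_ifs <;> simp [abs_mul, hg]

/-- The ℓ₁ error guarantee of the (one-row) count-sketch point estimate: for pairwise
independent uniform hash values `h(j)` and arbitrary `±1`-valued signs `g(j)`
independent of the `h`-family, `E[|x̃_i − x_i|] ≤ (Σ_{j≠i} |x_j|)/s ≤ ‖x‖₁/s`. -/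
theorem countSketch_l1_error {Ω : Type*} [MeasureSpace Ω]
    [IsProbabilityMeasure (ℙ : Measure Ω)]
    (u s : ℕ) (hu : 1 ≤ u) (hs : 1 ≤ s)
    (x : Fin u → ℝ) (i : Fin u)
    (h : Fin u → Ω → Fin s) (g : Fin u → Ω → ℝ)
    (hmeash : ∀ j, Measurable (h j)) (hmeasg : ∀ j, Measurable (g j))
    (hunif : ∀ j (c : Fin s), (ℙ : Measure Ω) {ω | h j ω = c} = (s : ENNReal)⁻¹)
    (hhpair : ∀ j j' : Fin u, j ≠ j' → IndepFun (h j) (h j') ℙ)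
    (hgval : ∀ j ω, g j ω = 1 ∨ g j ω = -1)
    (hfam : IndepFun (fun ω => fun j => g j ω) (fun ω => fun j => h j ω) ℙ) :
    (∫ ω, |(∑ j, if h j ω = h i ω then g i ω * g j ω * x j else 0) - x i| ∂ℙ) ≤
      (∑ j ∈ Finset.univ.erase i, |x j|) / s ∧
    (∑ j ∈ Finset.univ.erase i, |x j|) / (s : ℝ) ≤ (∑ j, |x j|) / s := by
  have habs (j : Fin u) (ω : Ω) : |g j ω| = 1 := by
    rcases hgval j ω with hj | hj <;> simp [hj]
  have hmeas (j : Fin u) : MeasurableSet {ω | h j ω = h i ω} :=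
    measurableSet_eq_fun (hmeash j) (hmeash i)
  have hind (j : Fin u) : (fun ω => if h j ω = h i ω then |x j| else 0) =
      {ω | h j ω = h i ω}.indicator fun _ => |x j| := by
    ext ω
    simp [Set.indicator_apply]
  have hint (j : Fin u) : Integrable (fun ω => if h j ω = h i ω then |x j| else 0) ℙ := by
    rw [hind]
    exact (integrable_const _).indicator (hmeas j)
  constructor
  · calc
      _ ≤ ∫ ω, ∑ j ∈ Finset.univ.erase i, (if h j ω = h i ω then |x j| else 0) ∂ℙ :=
        integral_mono_of_nonneg (.of_forall fun _ => abs_nonneg _)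
          (integrable_finsetSum _ fun j _ => hint j)
          (.of_forall fun ω => abs_countSketch_estimate_sub_le (fun j => h j ω)
            (fun j => g j ω) x (fun j => habs j ω) i)
      _ = ∑ j ∈ Finset.univ.erase i, |x j| / s := by
        rw [integral_finsetSum _ fun j _ => hint j]
        refine Finset.sum_congr rfl fun j hj => ?_
        rw [hind, integral_indicator_const _ (hmeas j),
          measureReal_eq_of_indepFun_uniform (Nat.one_le_iff_ne_zero.1 hs) (hmeash j) (hmeash i)
            (hunif j) (hunif i) (hhpair j i (Finset.ne_of_mem_erase hj)),
          smul_eq_mul, div_eq_inv_mul]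
      _ = _ := (Finset.sum_div _ _ _).symm
  · gcongr
    exact Finset.erase_subset _ _
end
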